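/- The pullback of the partial Jacobi endomorphism components along the embedded connection admits the expansion: for all i, ν, σ, Φ̄_{iν}^σ = Σ_k v^k·[ Z_i(H̄_{νk}^σ) − ∂F̄_{ik}^σ/∂y^ν + Σ_{j,ρ}(∂F_{ik}^σ/∂y_j^ρ ∘ s)·(∂Z_j^ρ/∂y^ν − H̄_{νj}^ρ) + Σ_ρ H̄_{νi}^ρ H̄_{ρk}^σ ], where Φ_{iν}^σ = Σ_k v^k (Γ_i(H_{νk}^σ) − H_ν(F_{ik}^σ) + Σ_ρ H_{νi}^ρ H_{ρk}^σ) and Φ̄_{iν}^σ = Φ_{iν}^σ ∘ s. (Displayed identity in the proof of the paper's Theorem 3.2.5.) -/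

import Mathlib

open scoped BigOperators

/-- Partial derivative in the base coordinate `x^i` of a function on
`ℝⁿ × ℝᵐ × ℝ^{nm}` (coordinates `(x^i, y^σ, y_j^σ)`). -/
noncomputable def pdx {n m : ℕ} (i : Fin n)
    (f : (Fin n → ℝ) × (Fin m → ℝ) × (Fin n → Fin m → ℝ) → ℝ)
    (w : (Fin n → ℝ) × (Fin m → ℝ) × (Fin n → Fin m → ℝ)) : ℝ :=
  deriv (fun t => f (Function.update w.1 i t, w.2.1, w.2.2)) (w.1 i)

/-- Partial derivative in the fibre coordinate `y^σ` of a function on `ℝⁿ × ℝᵐ × ℝ^{nm}`. -/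
noncomputable def pdy {n m : ℕ} (σ : Fin m)
    (f : (Fin n → ℝ) × (Fin m → ℝ) × (Fin n → Fin m → ℝ) → ℝ)
    (w : (Fin n → ℝ) × (Fin m → ℝ) × (Fin n → Fin m → ℝ)) : ℝ :=
  deriv (fun t => f (w.1, Function.update w.2.1 σ t, w.2.2)) (w.2.1 σ)

/-- Partial derivative in the derivative coordinate `y_j^σ` of a function on
`ℝⁿ × ℝᵐ × ℝ^{nm}`. -/
noncomputable def pdyj {n m : ℕ} (j : Fin n) (σ : Fin m)
    (f : (Fin n → ℝ) × (Fin m → ℝ) × (Fin n → Fin m → ℝ) → ℝ)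
    (w : (Fin n → ℝ) × (Fin m → ℝ) × (Fin n → Fin m → ℝ)) : ℝ :=
  deriv (fun t =>
    f (w.1, w.2.1, Function.update w.2.2 j (Function.update (w.2.2 j) σ t))) (w.2.2 j σ)

/-- Partial derivative in the `i`-th coordinate of a function on `ℝⁿ`. -/
noncomputable def xd {n : ℕ} (i : Fin n) (g : (Fin n → ℝ) → ℝ) (x : Fin n → ℝ) : ℝ :=
  deriv (fun t => g (Function.update x i t)) (x i)

/-- Partial derivative in the `i`-th base coordinate `x^i` of a function on `ℝⁿ × ℝᵐ`. -/
noncomputable def qdx {n m : ℕ} (i : Fin n) (g : (Fin n → ℝ) × (Fin m → ℝ) → ℝ)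
    (p : (Fin n → ℝ) × (Fin m → ℝ)) : ℝ :=
  deriv (fun t => g (Function.update p.1 i t, p.2)) (p.1 i)

/-- Partial derivative in the fibre coordinate `y^σ` of a function on `ℝⁿ × ℝᵐ`. -/
noncomputable def qdy {n m : ℕ} (σ : Fin m) (g : (Fin n → ℝ) × (Fin m → ℝ) → ℝ)
    (p : (Fin n → ℝ) × (Fin m → ℝ)) : ℝ :=
  deriv (fun t => g (p.1, Function.update p.2 σ t)) (p.2 σ)

/-- The vector field `Z_i = ∂/∂x^i + Z_i^σ ∂/∂y^σ` acting on functions on `ℝⁿ × ℝᵐ`. -/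
noncomputable def Zop {n m : ℕ} (Z : Fin n → Fin m → (Fin n → ℝ) × (Fin m → ℝ) → ℝ)
    (i : Fin n) (g : (Fin n → ℝ) × (Fin m → ℝ) → ℝ)
    (p : (Fin n → ℝ) × (Fin m → ℝ)) : ℝ :=
  qdx i g p + ∑ σ, Z i σ p * qdy σ g p

/-- The section `s(x,y) = (x, y, Z_j^ν(x,y))` associated with a first-order connection `Z`. -/
def sec {n m : ℕ} (Z : Fin n → Fin m → (Fin n → ℝ) × (Fin m → ℝ) → ℝ)
    (p : (Fin n → ℝ) × (Fin m → ℝ)) :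
    (Fin n → ℝ) × (Fin m → ℝ) × (Fin n → Fin m → ℝ) :=
  (p.1, p.2, fun j ν => Z j ν p)

/-- The operator `Γ_i = ∂/∂x^i + y_i^σ ∂/∂y^σ + F_{ij}^σ ∂/∂y_j^σ` acting on
functions on `ℝⁿ × ℝᵐ × ℝ^{nm}`. -/
noncomputable def Gammaop {n m : ℕ}
    (F : Fin n → Fin n → Fin m →
      (Fin n → ℝ) × (Fin m → ℝ) × (Fin n → Fin m → ℝ) → ℝ)
    (i : Fin n)
    (f : (Fin n → ℝ) × (Fin m → ℝ) × (Fin n → Fin m → ℝ) → ℝ)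
    (w : (Fin n → ℝ) × (Fin m → ℝ) × (Fin n → Fin m → ℝ)) : ℝ :=
  pdx i f w + ∑ σ, w.2.2 i σ * pdy σ f w + ∑ j, ∑ σ, F i j σ w * pdyj j σ f w

/-- The semi-horizontal components `H_{σk}^ν` determined by `F` and `v` in
adapted coordinates (`φ = dx¹`, index `1` realised as `0 : Fin n`):
`H_{σ1}^ν = ½(∂F_{11}^ν/∂y_1^σ − Σ_{p,q≥2} v^p v^q ∂F_{pq}^ν/∂y_1^σ)` and
`H_{σp}^ν = Σ_k v^k ∂F_{pk}^ν/∂y_1^σ` for `p ≥ 2`. -/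
noncomputable def Hfun {n m : ℕ} [NeZero n]
    (F : Fin n → Fin n → Fin m →
      (Fin n → ℝ) × (Fin m → ℝ) × (Fin n → Fin m → ℝ) → ℝ)
    (v : Fin n → (Fin n → ℝ) → ℝ)
    (σ : Fin m) (k : Fin n) (ν : Fin m)
    (w : (Fin n → ℝ) × (Fin m → ℝ) × (Fin n → Fin m → ℝ)) : ℝ :=
  if k = 0 then
    (1 / 2) * (pdyj 0 σ (F 0 0 ν) w
      - ∑ p ∈ Finset.univ.erase (0 : Fin n), ∑ q ∈ Finset.univ.erase (0 : Fin n),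
          v p w.1 * v q w.1 * pdyj 0 σ (F p q ν) w)
  else
    ∑ j, v j w.1 * pdyj 0 σ (F k j ν) w

/-- The operator `H_ν = ∂/∂y^ν + H_{νk}^σ ∂/∂y_k^σ` acting on functions on
`ℝⁿ × ℝᵐ × ℝ^{nm}`. -/
noncomputable def Hop {n m : ℕ}
    (H : Fin m → Fin n → Fin m →
      (Fin n → ℝ) × (Fin m → ℝ) × (Fin n → Fin m → ℝ) → ℝ)
    (ν : Fin m)
    (f : (Fin n → ℝ) × (Fin m → ℝ) × (Fin n → Fin m → ℝ) → ℝ)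
    (w : (Fin n → ℝ) × (Fin m → ℝ) × (Fin n → Fin m → ℝ)) : ℝ :=
  pdy ν f w + ∑ k, ∑ σ, H ν k σ w * pdyj k σ f w

/-- The components `Φ_{iν}^σ = Σ_k v^k (Γ_i(H_{νk}^σ) − H_ν(F_{ik}^σ) + Σ_ρ H_{νi}^ρ H_{ρk}^σ)`
of the partial Jacobi endomorphism. -/
noncomputable def Phi {n m : ℕ} [NeZero n]
    (F : Fin n → Fin n → Fin m →
      (Fin n → ℝ) × (Fin m → ℝ) × (Fin n → Fin m → ℝ) → ℝ)
    (v : Fin n → (Fin n → ℝ) → ℝ)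
    (i : Fin n) (ν : Fin m) (σ : Fin m)
    (w : (Fin n → ℝ) × (Fin m → ℝ) × (Fin n → Fin m → ℝ)) : ℝ :=
  ∑ k, v k w.1 *
    (Gammaop F i (Hfun F v ν k σ) w - Hop (Hfun F v) ν (F i k σ) w
      + ∑ ρ, Hfun F v ν i ρ w * Hfun F v ρ k σ w)

theorem pdx_eq {n m : ℕ} (i : Fin n)
    (f : (Fin n → ℝ) × (Fin m → ℝ) × (Fin n → Fin m → ℝ) → ℝ) (hf : Differentiable ℝ f)
    (w : (Fin n → ℝ) × (Fin m → ℝ) × (Fin n → Fin m → ℝ)) :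
    pdx i f w = fderiv ℝ f w (Pi.single i 1, 0, 0) := by
  have hc : HasDerivAt (fun t : ℝ => (Function.update w.1 i t, w.2.1, w.2.2))
      (Pi.single i 1, 0, 0) (w.1 i) :=
    (hasDerivAt_update w.1 i (w.1 i)).prodMk
      ((hasDerivAt_const _ _).prodMk (hasDerivAt_const _ _))
  have h := HasFDerivAt.comp_hasDerivAt_of_eq (w.1 i) (hf w).hasFDerivAt hc (by simp)
  exact h.deriv

theorem pdy_eq {n m : ℕ} (i : Fin m)
    (f : (Fin n → ℝ) × (Fin m → ℝ) × (Fin n → Fin m → ℝ) → ℝ) (hf : Differentiable ℝ f)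
    (w : (Fin n → ℝ) × (Fin m → ℝ) × (Fin n → Fin m → ℝ)) :
    pdy i f w = fderiv ℝ f w (0, Pi.single i 1, 0) := by
  have hc : HasDerivAt (fun t : ℝ => (w.1, Function.update w.2.1 i t, w.2.2))
      (0, Pi.single i 1, 0) (w.2.1 i) :=
    (hasDerivAt_const _ _).prodMk
      ((hasDerivAt_update w.2.1 i (w.2.1 i)).prodMk (hasDerivAt_const _ _))
  have h := HasFDerivAt.comp_hasDerivAt_of_eq (w.2.1 i) (hf w).hasFDerivAt hc (by simp)
  exact h.deriv

theorem pdyj_eq {n m : ℕ} (j : Fin n) (σ : Fin m)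
    (f : (Fin n → ℝ) × (Fin m → ℝ) × (Fin n → Fin m → ℝ) → ℝ) (hf : Differentiable ℝ f)
    (w : (Fin n → ℝ) × (Fin m → ℝ) × (Fin n → Fin m → ℝ)) :
    pdyj j σ f w = fderiv ℝ f w (0, 0, Pi.single j (Pi.single σ 1)) := by
  have hu : HasDerivAt
      (fun t : ℝ => Function.update w.2.2 j (Function.update (w.2.2 j) σ t))
      (Pi.single j (Pi.single σ 1)) (w.2.2 j σ) := by
    rw [hasDerivAt_pi]
    intro k
    by_cases hk : k = j
    · subst hk
      simpa using hasDerivAt_update (w.2.2 k) σ (w.2.2 k σ)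
    · simpa [hk] using hasDerivAt_const (w.2.2 j σ) (w.2.2 k)
  have hc : HasDerivAt (fun t : ℝ =>
      (w.1, w.2.1, Function.update w.2.2 j (Function.update (w.2.2 j) σ t)))
      (0, 0, Pi.single j (Pi.single σ 1)) (w.2.2 j σ) :=
    (hasDerivAt_const _ _).prodMk ((hasDerivAt_const _ _).prodMk hu)
  have h := HasFDerivAt.comp_hasDerivAt_of_eq (w.2.2 j σ) (hf w).hasFDerivAt hc (by simp)
  exact h.deriv

/-- Expansion of a linear functional along the jet directions. -/
theorem lin_expand {n m : ℕ}
    (L : (Fin n → ℝ) × (Fin m → ℝ) × (Fin n → Fin m → ℝ) →L[ℝ] ℝ)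
    (a : Fin n → ℝ) (b : Fin m → ℝ) (c : Fin n → Fin m → ℝ) :
    L (a, b, c) = L (a, 0, 0) + L (0, b, 0)
      + ∑ j, ∑ σ, c j σ * L (0, 0, Pi.single j (Pi.single σ 1)) := by
  have h1 : (a, b, c) = (a, (0 : Fin m → ℝ), (0 : Fin n → Fin m → ℝ)) + (0, b, 0)
      + ∑ j, ∑ σ, c j σ • ((0 : Fin n → ℝ), (0 : Fin m → ℝ),
          (Pi.single j (Pi.single σ (1 : ℝ)) : Fin n → Fin m → ℝ)) := by
    refine Prod.ext ?_ (Prod.ext ?_ ?_)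
    · simp [Prod.fst_sum]
    · simp [Prod.fst_sum, Prod.snd_sum]
    · funext k ρ
      simp [Prod.snd_sum, Finset.sum_apply, Pi.single_apply, Finset.sum_ite_eq]
  rw [h1]
  simp only [map_add, map_sum, map_smul, smul_eq_mul]

theorem qdx_comp_sec {n m : ℕ} (Z : Fin n → Fin m → (Fin n → ℝ) × (Fin m → ℝ) → ℝ)
    (hZ : ∀ i σ, Differentiable ℝ (Z i σ)) (i : Fin n)
    (f : (Fin n → ℝ) × (Fin m → ℝ) × (Fin n → Fin m → ℝ) → ℝ) (hf : Differentiable ℝ f)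
    (p : (Fin n → ℝ) × (Fin m → ℝ)) :
    qdx i (fun q => f (sec Z q)) p = pdx i f (sec Z p)
      + ∑ j, ∑ σ, qdx i (Z j σ) p * pdyj j σ f (sec Z p) := by
  have hc0 : HasDerivAt (fun t : ℝ => (Function.update p.1 i t, p.2))
      (Pi.single i 1, 0) (p.1 i) :=
    (hasDerivAt_update p.1 i (p.1 i)).prodMk (hasDerivAt_const _ _)
  have hd : DifferentiableAt ℝ (fun t : ℝ => (Function.update p.1 i t, p.2)) (p.1 i) :=
    hc0.differentiableAt
  have hc : HasDerivAt (fun t : ℝ => sec Z (Function.update p.1 i t, p.2))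
      (Pi.single i 1, 0, fun j σ => qdx i (Z j σ) p) (p.1 i) := by
    refine (hasDerivAt_update p.1 i (p.1 i)).prodMk ((hasDerivAt_const _ _).prodMk ?_)
    refine hasDerivAt_pi.2 fun j => hasDerivAt_pi.2 fun σ => ?_
    exact (DifferentiableAt.comp (p.1 i) (hZ j σ _) hd).hasDerivAt
  have h := HasFDerivAt.comp_hasDerivAt_of_eq (p.1 i) (hf (sec Z p)).hasFDerivAt hc (by simp)
  refine h.deriv.trans ?_
  rw [lin_expand, pdx_eq i f hf]
  simp only [pdyj_eq _ _ f hf]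
  simp
  exact map_zero _

theorem qdy_comp_sec {n m : ℕ} (Z : Fin n → Fin m → (Fin n → ℝ) × (Fin m → ℝ) → ℝ)
    (hZ : ∀ i σ, Differentiable ℝ (Z i σ)) (i : Fin m)
    (f : (Fin n → ℝ) × (Fin m → ℝ) × (Fin n → Fin m → ℝ) → ℝ) (hf : Differentiable ℝ f)
    (p : (Fin n → ℝ) × (Fin m → ℝ)) :
    qdy i (fun q => f (sec Z q)) p = pdy i f (sec Z p)
      + ∑ j, ∑ σ, qdy i (Z j σ) p * pdyj j σ f (sec Z p) := by
  have hc0 : HasDerivAt (fun t : ℝ => (p.1, Function.update p.2 i t))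
      (0, Pi.single i 1) (p.2 i) :=
    (hasDerivAt_const _ _).prodMk (hasDerivAt_update p.2 i (p.2 i))
  have hd : DifferentiableAt ℝ (fun t : ℝ => (p.1, Function.update p.2 i t)) (p.2 i) :=
    hc0.differentiableAt
  have hc : HasDerivAt (fun t : ℝ => sec Z (p.1, Function.update p.2 i t))
      (0, Pi.single i 1, fun j σ => qdy i (Z j σ) p) (p.2 i) := by
    refine (hasDerivAt_const _ _).prodMk ((hasDerivAt_update p.2 i (p.2 i)).prodMk ?_)
    refine hasDerivAt_pi.2 fun j => hasDerivAt_pi.2 fun σ => ?_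
    exact (DifferentiableAt.comp (p.2 i) (hZ j σ _) hd).hasDerivAt
  have h := HasFDerivAt.comp_hasDerivAt_of_eq (p.2 i) (hf (sec Z p)).hasFDerivAt hc (by simp)
  refine h.deriv.trans ?_
  rw [lin_expand, pdy_eq i f hf]
  simp only [pdyj_eq _ _ f hf]
  simp
  exact map_zero _

theorem Gamma_comp_sec {n m : ℕ}
    (F : Fin n → Fin n → Fin m →
      (Fin n → ℝ) × (Fin m → ℝ) × (Fin n → Fin m → ℝ) → ℝ)
    (Z : Fin n → Fin m → (Fin n → ℝ) × (Fin m → ℝ) → ℝ)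
    (hZ : ∀ i σ, Differentiable ℝ (Z i σ))
    (hemb : ∀ i j σ p, Zop Z i (Z j σ) p = F i j σ (sec Z p)) (i : Fin n)
    (f : (Fin n → ℝ) × (Fin m → ℝ) × (Fin n → Fin m → ℝ) → ℝ) (hf : Differentiable ℝ f)
    (p : (Fin n → ℝ) × (Fin m → ℝ)) :
    Gammaop F i f (sec Z p) = Zop Z i (fun q => f (sec Z q)) p := by
  unfold Gammaop
  simp only [← hemb]
  unfold Zop
  rw [qdx_comp_sec Z hZ i f hf]
  simp only [qdy_comp_sec Z hZ _ f hf, mul_add, add_mul, Finset.sum_add_distrib,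
    Finset.mul_sum, Finset.sum_mul]
  have e : ∑ τ, ∑ j, ∑ σ, Z i τ p * (qdy τ (Z j σ) p * pdyj j σ f (sec Z p))
      = ∑ j, ∑ σ, ∑ τ, Z i τ p * qdy τ (Z j σ) p * pdyj j σ f (sec Z p) := by
    rw [Finset.sum_comm]
    refine Finset.sum_congr rfl fun j _ => ?_
    rw [Finset.sum_comm]
    simp only [mul_assoc]
  rw [e]
  simp only [sec]
  ring

theorem Hfun_differentiable {n m : ℕ} [NeZero n]
    (F : Fin n → Fin n → Fin m →
      (Fin n → ℝ) × (Fin m → ℝ) × (Fin n → Fin m → ℝ) → ℝ)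
    (hF : ∀ i j σ, ContDiff ℝ (⊤ : ℕ∞) (F i j σ))
    (v : Fin n → (Fin n → ℝ) → ℝ)
    (hv : ∀ i, ContDiff ℝ (⊤ : ℕ∞) (v i))
    (σ : Fin m) (k : Fin n) (ν : Fin m) : Differentiable ℝ (Hfun F v σ k ν) := by
  have hp : ∀ i j, Differentiable ℝ (pdyj 0 σ (F i j ν)) := by
    intro i j
    have : pdyj 0 σ (F i j ν)
        = fun w => fderiv ℝ (F i j ν) w (0, 0, Pi.single 0 (Pi.single σ 1)) :=
      funext (pdyj_eq 0 σ _ ((hF i j ν).differentiable (by simp)))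
    rw [this]
    have h1 : Differentiable ℝ (fderiv ℝ (F i j ν)) :=
      ((hF i j ν).fderiv_right (m := (⊤ : ℕ∞)) (by first | exact le_rfl | simp | norm_cast)).differentiable (by simp)
    exact h1.clm_apply (differentiable_const _)
  have hv' : ∀ i, Differentiable ℝ
      (fun w : (Fin n → ℝ) × (Fin m → ℝ) × (Fin n → Fin m → ℝ) => v i w.1) := fun i =>
    ((hv i).differentiable (by simp)).comp differentiable_fst
  unfold Hfun
  by_cases hk : k = 0
  · simp only [hk, if_true]
    exact ((hp 0 0).sub (Differentiable.fun_sum fun a _ => Differentiable.fun_sum fun b _ =>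
      ((hv' a).mul (hv' b)).mul (hp a b))).const_mul _
  · simp only [hk, if_false]
    exact Differentiable.fun_sum fun a _ => (hv' a).mul (hp k a)

/-- Displayed identity in the proof of Theorem 3.2.5: the pullback of the
partial Jacobi endomorphism components along the embedded connection admits
the stated expansion. -/
theorem jacobi_pullback_expansion
    (n m : ℕ)
    (F : Fin (n + 2) → Fin (n + 2) → Fin (m + 1) →
      (Fin (n + 2) → ℝ) × (Fin (m + 1) → ℝ) × (Fin (n + 2) → Fin (m + 1) → ℝ) → ℝ)
    (hF : ∀ i j σ, ContDiff ℝ (⊤ : ℕ∞) (F i j σ))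
    (hFsymm : ∀ i j σ, F i j σ = F j i σ)
    (Z : Fin (n + 2) → Fin (m + 1) → (Fin (n + 2) → ℝ) × (Fin (m + 1) → ℝ) → ℝ)
    (hZ : ∀ i σ, ContDiff ℝ (⊤ : ℕ∞) (Z i σ))
    (hemb : ∀ i j σ p, Zop Z i (Z j σ) p = F i j σ (sec Z p))
    (v : Fin (n + 2) → (Fin (n + 2) → ℝ) → ℝ)
    (hv : ∀ i, ContDiff ℝ (⊤ : ℕ∞) (v i))
    (hv1 : ∀ x, v 0 x = 1) :
    ∀ (i : Fin (n + 2)) (ν σ : Fin (m + 1)) (p : (Fin (n + 2) → ℝ) × (Fin (m + 1) → ℝ)),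
      Phi F v i ν σ (sec Z p)
        = ∑ k, v k p.1 *
            (Zop Z i (fun q => Hfun F v ν k σ (sec Z q)) p
              - qdy ν (fun q => F i k σ (sec Z q)) p
              + ∑ j, ∑ ρ, pdyj j ρ (F i k σ) (sec Z p) *
                  (qdy ν (Z j ρ) p - Hfun F v ν j ρ (sec Z p))
              + ∑ ρ, Hfun F v ν i ρ (sec Z p) * Hfun F v ρ k σ (sec Z p)) := by
  intro i ν σ p
  have hZ' : ∀ i σ, Differentiable ℝ (Z i σ) := fun i σ => (hZ i σ).differentiable (by simp)
  unfold Phi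
  refine Finset.sum_congr rfl fun k _ => ?_
  rw [Gamma_comp_sec F Z hZ' hemb i _ (Hfun_differentiable F hF v hv ν k σ) p,
    qdy_comp_sec Z hZ' ν (F i k σ) ((hF i k σ).differentiable (by simp)) p]
  have hx : (sec Z p).1 = p.1 := rfl
  rw [hx]
  unfold Hop
  have e : ∑ j, ∑ ρ, pdyj j ρ (F i k σ) (sec Z p) *
                  (qdy ν (Z j ρ) p - Hfun F v ν j ρ (sec Z p))
      = ∑ j, ∑ ρ, qdy ν (Z j ρ) p * pdyj j ρ (F i k σ) (sec Z p)
        - ∑ j, ∑ ρ, Hfun F v ν j ρ (sec Z p) * pdyj j ρ (F i k σ) (sec Z p) := by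
    simp only [← Finset.sum_sub_distrib]
    refine Finset.sum_congr rfl fun j _ => Finset.sum_congr rfl fun ρ _ => ?_
    ring
  rw [e]
  ring
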